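/- arXiv:1703.03163 — 5 statements merged into one kernel-verified Lean document; each statement's English description precedes it below -/
import Mathlib

section
/- For every integer n ≥ 1, every x ∈ I₀ and all ω, ω′ ∈ Ω, one has d_M(f_ω^{(n)}(x), X_{ω′}) ≤ 2^{−n} + 6ε · max_{0 ≤ j ≤ n−1} |κ(θ^j ω) − κ(ω′)|. -/
open MeasureTheory Filter Metric Set Topology

noncomputable section

/-- The circle `M = ℝ/ℤ`. -/
abbrev Circle1 : Type := AddCircle (1 : ℝ)

/-- `I₀ = π_M([1/4, 3/4])`. -/
def I0 : Set Circle1 := (fun x : ℝ => (x : Circle1)) '' Set.Icc (1/4 : ℝ) (3/4)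

/-- The iterates of the nonautonomous dynamical system induced by `f` over `θ`. -/
def ndsIter {Ω : Type*} (θ : Ω → Ω) (f : Ω → Circle1 → Circle1) : ℕ → Ω → Circle1 → Circle1
  | 0, _, x => x
  | n + 1, ω, x => ndsIter θ f n (θ ω) (f ω x)

/-- The circle distance is bounded by the distance of any two real representatives. -/
theorem dist_coe_le_abs_sub (s t : ℝ) : dist (s : Circle1) (t : Circle1) ≤ |s - t| := by
  rw [dist_eq_norm, ← AddCircle.coe_sub, ← Real.norm_eq_abs]
  exact QuotientAddGroup.norm_mk_le_norm

/-- An orbit starting in `I₀` lifts to `[1/4, 3/4]`, where each step contracts the distance to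
`1/2 + 2εc` by a factor `1/2`, up to an error `εC`. -/
theorem exists_lift_ndsIter
    {Ω : Type*} {θ : Ω → Ω} {f0 : Circle1 → Circle1}
    (hf0 : ∀ xt ∈ Set.Icc (1/4 : ℝ) (3/4), f0 (xt : Circle1) = ((xt / 2 + 1/4 : ℝ) : Circle1))
    {ε : ℝ} (hε0 : 0 ≤ ε) (hε1 : ε ≤ 1/8)
    {κ : Ω → ℝ} (hκrange : ∀ ω, κ ω ∈ Set.Icc (-1 : ℝ) 1)
    {f : Ω → Circle1 → Circle1}
    (hf : ∀ ω x, f ω x = f0 x + ((ε * κ ω : ℝ) : Circle1))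
    (c C : ℝ) (n : ℕ) (ω : Ω) (t : ℝ) (ht : t ∈ Set.Icc (1/4 : ℝ) (3/4))
    (hC : ∀ j < n, |κ (θ^[j] ω) - c| ≤ C) :
    ∃ s : ℝ, ndsIter θ f n ω t = s ∧
      |s - (1/2 + 2 * ε * c)| ≤
        (1/2 : ℝ) ^ n * (|t - (1/2 + 2 * ε * c)| - 2 * ε * C) + 2 * ε * C := by
  induction n generalizing ω t with
  | zero => exact ⟨t, rfl, by simp⟩
  | succ n ih =>
    have hstep : f ω t = ((t / 2 + 1/4 + ε * κ ω : ℝ) : Circle1) := by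
      rw [hf, hf0 t ht, ← AddCircle.coe_add]
    have hmem : t / 2 + 1/4 + ε * κ ω ∈ Set.Icc (1/4 : ℝ) (3/4) := by
      obtain ⟨h1, h2⟩ := hκrange ω
      obtain ⟨h3, h4⟩ := ht
      constructor <;> nlinarith
    obtain ⟨s, hs, hle⟩ := ih (θ ω) _ hmem fun j hj => hC (j + 1) (by omega)
    refine ⟨s, by rw [ndsIter, hstep, hs], hle.trans ?_⟩
    have hκ : |κ ω - c| ≤ C := hC 0 n.succ_pos
    have hcontr : |t / 2 + 1/4 + ε * κ ω - (1/2 + 2 * ε * c)| ≤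
        |t - (1/2 + 2 * ε * c)| / 2 + ε * C := by
      calc |t / 2 + 1/4 + ε * κ ω - (1/2 + 2 * ε * c)|
          = |(t - (1/2 + 2 * ε * c)) / 2 + ε * (κ ω - c)| := by ring_nf
        _ ≤ |(t - (1/2 + 2 * ε * c)) / 2| + |ε * (κ ω - c)| := abs_add_le _ _
        _ = |t - (1/2 + 2 * ε * c)| / 2 + ε * |κ ω - c| := by
          rw [abs_div, abs_two, abs_mul, abs_of_nonneg hε0]
        _ ≤ _ := by gcongr
    have hpow := mul_le_mul_of_nonneg_left hcontr (show (0 : ℝ) ≤ (1/2) ^ n by positivity)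
    rw [pow_succ]
    linarith

/-- **Lemma 1.** For `n ≥ 1`, `x ∈ I₀` and `ω, ω' ∈ Ω`,
`d_M(f_ω^{(n)}(x), X_{ω'}) ≤ 2^{-n} + 6ε · max_{0 ≤ j ≤ n-1} |κ(θ^j ω) - κ(ω')|`. -/
theorem dist_ndsIter_fixedPoint_le
    {Ω : Type*} (θ : Ω → Ω)
    (f0 : Circle1 → Circle1)
    (hf0 : ∀ xt ∈ Set.Icc (1/4 : ℝ) (3/4), f0 (xt : Circle1) = ((xt / 2 + 1/4 : ℝ) : Circle1))
    (ε : ℝ) (hε0 : 0 < ε) (hε1 : ε < 1/8)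
    (κ : Ω → ℝ) (hκrange : ∀ ω, κ ω ∈ Set.Icc (-1 : ℝ) 1)
    (f : Ω → Circle1 → Circle1)
    (hf : ∀ ω x, f ω x = f0 x + ((ε * κ ω : ℝ) : Circle1))
    (X : Ω → Circle1) (hX : ∀ ω, X ω = ((1/2 + 2 * ε * κ ω : ℝ) : Circle1))
    (n : ℕ) (hn : 1 ≤ n) (x : Circle1) (hx : x ∈ I0) (ω ω' : Ω) :
    dist (ndsIter θ f n ω x) (X ω') ≤
      (1/2 : ℝ) ^ n + 6 * ε *
        (Finset.range n).sup' (Finset.nonempty_range_iff.mpr (by omega))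
          (fun j => |κ (θ^[j] ω) - κ ω'|) := by
  obtain ⟨t, ht, rfl⟩ := hx
  set C := (Finset.range n).sup' (Finset.nonempty_range_iff.mpr (by omega))
    (fun j => |κ (θ^[j] ω) - κ ω'|)
  have hC : ∀ j < n, |κ (θ^[j] ω) - κ ω'| ≤ C := fun j hj =>
    Finset.le_sup' (fun j => |κ (θ^[j] ω) - κ ω'|) (Finset.mem_range.mpr hj)
  have hC0 : 0 ≤ ε * C := mul_nonneg hε0.le ((abs_nonneg _).trans (hC 0 (by omega)))
  obtain ⟨s, hs, hle⟩ := exists_lift_ndsIter hf0 hε0.le hε1.le hκrange hf (κ ω') C n ω t ht hC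
  have hstart : |t - (1/2 + 2 * ε * κ ω')| ≤ 1 := by
    obtain ⟨h1, h2⟩ := hκrange ω'
    obtain ⟨h3, h4⟩ := ht
    rw [abs_le]
    constructor <;> nlinarith
  have hp : (0 : ℝ) ≤ (1/2) ^ n := by positivity
  rw [hX]
  change dist (ndsIter θ f n ω (t : Circle1)) _ ≤ _
  rw [hs]
  refine (dist_coe_le_abs_sub _ _).trans (hle.trans ?_)
  nlinarith [mul_le_mul_of_nonneg_left hstart hp, mul_nonneg hp hC0]

end
end

section
/- Let (Ω, ℱ, ℙ) be a probability space, θ : Ω → Ω a bimeasurable bijection such that both θ and θ^{−1} are nonsingular with respect to ℙ, and κ : Ω → [−1,1] a measurable function. Assume θ is non-historic, i.e. the set of ω ∈ Ω for which there exists a ℙ-integrable function b : Ω → ℝ such that lim_{n→∞} (1/n) Σ_{j=0}^{n−1} b(θ^j ω) does not exist is contained in a ℙ-null set. Then for ℙ-almost every ω ∈ Ω, the set of points x ∈ I₀ with historic behaviour at ω is empty; in particular it has Lebesgue measure zero. -/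
open MeasureTheory Filter Metric Set Topology

noncomputable section

/-- `x` has historic behaviour at `ω`. -/
def HistoricAt {Ω : Type*} (θ : Ω → Ω) (f : Ω → Circle1 → Circle1) (ω : Ω) (x : Circle1) : Prop :=
  ∃ φ : Circle1 → ℝ, Continuous φ ∧
    ¬ ∃ L : ℝ, Tendsto (fun n : ℕ => (n : ℝ)⁻¹ * ∑ j ∈ Finset.range n, φ (ndsIter θ f j ω x))
      atTop (𝓝 L)

/-- The real lift of `x ↦ f_ω x` contracts towards any equivariant lift `X`. -/
theorem ndsIter_coe_sub {Ω : Type*} {θ : Ω → Ω} {κ X : Ω → ℝ} {f0 : Circle1 → Circle1}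
    (hf0 : ∀ xt ∈ Set.Icc (1/4 : ℝ) (3/4), f0 (xt : Circle1) = ((xt / 2 + 1/4 : ℝ) : Circle1))
    {ε : ℝ} (hε0 : 0 < ε) (hε1 : ε < 1/8) {f : Ω → Circle1 → Circle1}
    (hf : ∀ ω x, f ω x = f0 x + ((ε * κ ω : ℝ) : Circle1)) (n : ℕ) :
    ∀ (ω : Ω) (t : ℝ), (∀ j : ℕ, κ (θ^[j] ω) ∈ Set.Icc (-1 : ℝ) 1) →
      (∀ j : ℕ, X (θ^[j + 1] ω) = X (θ^[j] ω) / 2 + 1/4 + ε * κ (θ^[j] ω)) →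
      t ∈ Set.Icc (1/4 : ℝ) (3/4) →
      ∃ s : ℝ, ndsIter θ f n ω t = (s : Circle1) ∧
        s - X (θ^[n] ω) = (1/2) ^ n * (t - X ω) := by
  induction n with
  | zero => intro ω t _ _ _; exact ⟨t, rfl, by simp⟩
  | succ n ih =>
    intro ω t hκ hX ht
    have h0 := hκ 0
    have hX0 := hX 0
    simp only [Function.iterate_succ, Function.comp, Function.iterate_zero, id] at h0 hX0
    obtain ⟨s, hs, hs'⟩ := ih (θ ω) (t / 2 + 1/4 + ε * κ ω)
      (fun j => hκ (j + 1)) (fun j => hX (j + 1))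
      ⟨by nlinarith [h0.1, ht.1], by nlinarith [h0.2, ht.2]⟩
    refine ⟨s, ?_, ?_⟩
    · rw [← hs]
      change ndsIter θ f n (θ ω) (f ω t) = _
      rw [hf, hf0 t ht, ← AddCircle.coe_add]
    · rw [Function.iterate_succ_apply, hs', hX0, pow_succ]
      ring

/-- A bounded measurable forcing has a measurable equivariant solution of the fibrewise affine
recursion, obtained by summing over the past. -/
theorem exists_measurable_equivariant {Ω : Type*} [MeasurableSpace Ω] {θ θinv : Ω → Ω}
    (hθinvmeas : Measurable θinv) (hleft : Function.LeftInverse θinv θ)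
    {c : Ω → ℝ} (hc : Measurable c) {C : ℝ} (hC : ∀ ω, |c ω| ≤ C) :
    ∃ X : Ω → ℝ, Measurable X ∧ ∀ ω, X (θ ω) = X ω / 2 + 1/4 + c ω := by
  have hsum : ∀ ω, Summable fun k : ℕ => (1/2 : ℝ) ^ k * c (θinv^[k + 1] ω) := fun ω =>
    Summable.of_norm_bounded (summable_geometric_two.mul_right C) fun k => by
      rw [norm_mul, Real.norm_eq_abs, Real.norm_eq_abs, abs_of_nonneg (by positivity)]
      gcongr
      exact hC _
  refine ⟨fun ω => 1/2 + ∑' k : ℕ, (1/2 : ℝ) ^ k * c (θinv^[k + 1] ω), ?_, fun ω => ?_⟩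
  · refine measurable_const.add (measurable_of_tendsto_metrizable (fun n => ?_)
      (tendsto_pi_nhds.2 fun ω => (hsum ω).hasSum.tendsto_sum_nat))
    exact Finset.measurable_fun_sum _ fun k _ =>
      measurable_const.mul (hc.comp (hθinvmeas.iterate (k + 1)))
  · have h := (hsum (θ ω)).tsum_eq_zero_add
    have h' : ∀ k : ℕ, (1/2 : ℝ) ^ (k + 1) * c (θinv^[k + 1 + 1] (θ ω)) =
        1/2 * ((1/2 : ℝ) ^ k * c (θinv^[k + 1] ω)) := fun k => by
      rw [Function.iterate_succ_apply, hleft]; ring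
    simp only [h', tsum_mul_left, zero_add, Function.iterate_one, hleft ω] at h
    simp only [h]
    ring

/-- Two sequences with asymptotically vanishing difference have the same Cesàro limits. -/
theorem tendsto_cesaro_of_sub {u v : ℕ → ℝ} {L : ℝ}
    (huv : Tendsto (fun n => u n - v n) atTop (𝓝 0))
    (hv : Tendsto (fun n : ℕ => (n : ℝ)⁻¹ * ∑ j ∈ Finset.range n, v j) atTop (𝓝 L)) :
    Tendsto (fun n : ℕ => (n : ℝ)⁻¹ * ∑ j ∈ Finset.range n, u j) atTop (𝓝 L) := by
  have h := huv.cesaro.add hv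
  rw [zero_add] at h
  refine h.congr fun n => ?_
  rw [Finset.sum_sub_distrib]
  ring

/-- A full-measure property holds along almost every forward orbit of a nonsingular map. -/
theorem ae_forall_iterate {Ω : Type*} [MeasurableSpace Ω] {ℙ : Measure Ω} [IsProbabilityMeasure ℙ]
    {θ : Ω → Ω} (hθ : Measurable θ)
    (hns : ∀ Γ : Set Ω, MeasurableSet Γ → ℙ Γ = 1 → ℙ (θ ⁻¹' Γ) = 1)
    {S : Set Ω} (hS : MeasurableSet S) (h : ∀ᵐ ω ∂ℙ, ω ∈ S) :
    ∀ᵐ ω ∂ℙ, ∀ j : ℕ, θ^[j] ω ∈ S := by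
  refine ae_all_iff.2 fun j => ?_
  have hj : MeasurableSet (θ^[j] ⁻¹' S) ∧ ℙ (θ^[j] ⁻¹' S) = 1 := by
    induction j with
    | zero => exact ⟨hS, (prob_compl_eq_zero_iff hS).1 h⟩
    | succ j ih =>
      rw [Function.iterate_succ, Set.preimage_comp]
      exact ⟨hθ ih.1, hns _ ih.1 ih.2⟩
  exact (prob_compl_eq_zero_iff hj.1).2 hj.2

/-- **Proposition 4.** If the driving system `θ` (a bimeasurable bijection,
nonsingular in both directions) is non-historic, then for `ℙ`-almost every `ω` the set of points
of `I₀` with historic behaviour at `ω` is empty; in particular it has Lebesgue measure zero. -/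
theorem no_historic_over_nonhistoric_driving
    {Ω : Type*} [MeasurableSpace Ω] (ℙ : Measure Ω) [IsProbabilityMeasure ℙ]
    (θ θinv : Ω → Ω) (hθmeas : Measurable θ) (hθinvmeas : Measurable θinv)
    (hleft : Function.LeftInverse θinv θ) (hright : Function.RightInverse θinv θ)
    (hns : ∀ Γ : Set Ω, MeasurableSet Γ → ℙ Γ = 1 → ℙ (θ ⁻¹' Γ) = 1)
    (hns' : ∀ Γ : Set Ω, MeasurableSet Γ → ℙ Γ = 1 → ℙ (θinv ⁻¹' Γ) = 1)
    (κ : Ω → ℝ) (hκmeas : Measurable κ) (hκrange : ∀ᵐ ω ∂ℙ, κ ω ∈ Set.Icc (-1 : ℝ) 1)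
    (f0 : Circle1 → Circle1)
    (hf0 : ∀ xt ∈ Set.Icc (1/4 : ℝ) (3/4), f0 (xt : Circle1) = ((xt / 2 + 1/4 : ℝ) : Circle1))
    (ε : ℝ) (hε0 : 0 < ε) (hε1 : ε < 1/8)
    (f : Ω → Circle1 → Circle1)
    (hf : ∀ ω x, f ω x = f0 x + ((ε * κ ω : ℝ) : Circle1))
    (hnonhistoric : ∃ N : Set Ω, ℙ N = 0 ∧
      {ω : Ω | ∃ b : Ω → ℝ, Integrable b ℙ ∧
        ¬ ∃ L : ℝ, Tendsto (fun n : ℕ => (n : ℝ)⁻¹ * ∑ j ∈ Finset.range n, b (θ^[j] ω))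
          atTop (𝓝 L)} ⊆ N) :
    ∀ᵐ ω ∂ℙ, ∀ x ∈ I0, ¬ HistoricAt θ f ω x := by
  obtain ⟨N, hN, hsub⟩ := hnonhistoric
  have hN' : ∀ᵐ ω ∂ℙ, ω ∉ N := measure_eq_zero_iff_ae_notMem.1 hN
  have hclip : ∀ y : ℝ, |ε * max (-1) (min 1 y)| ≤ ε := fun y => by
    rw [abs_mul, abs_of_pos hε0]
    refine mul_le_of_le_one_right hε0.le (abs_le.2 ⟨le_max_left _ _, ?_⟩)
    exact max_le (by norm_num) (min_le_left _ _)
  obtain ⟨X, hXmeas, hX⟩ := exists_measurable_equivariant hθinvmeas hleft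
    (c := fun ω => ε * max (-1) (min 1 (κ ω)))
    (measurable_const.mul (measurable_const.max (measurable_const.min hκmeas)))
    fun ω => hclip (κ ω)
  filter_upwards [hN', ae_forall_iterate hθmeas hns (hκmeas measurableSet_Icc) hκrange]
    with ω hω hκω
  rintro _ ⟨t, ht, rfl⟩ ⟨φ, hφ, hno⟩
  have hXω : ∀ j : ℕ, X (θ^[j + 1] ω) = X (θ^[j] ω) / 2 + 1/4 + ε * κ (θ^[j] ω) := fun j => by
    have hj : κ (θ^[j] ω) ∈ Set.Icc (-1 : ℝ) 1 := hκω j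
    rw [Function.iterate_succ_apply', hX, min_eq_right hj.2, max_eq_right hj.1]
  have hψ : Continuous fun s : ℝ => φ (s : Circle1) := hφ.comp (AddCircle.continuous_mk' 1)
  have hφu : UniformContinuous φ := CompactSpace.uniformContinuous_of_continuous hφ
  obtain ⟨B, hB⟩ := isCompact_univ.exists_bound_of_continuousOn hφ.continuousOn
  have hint : Integrable (fun ω => φ (X ω : Circle1)) ℙ :=
    Integrable.of_bound (hψ.measurable.comp hXmeas).aestronglyMeasurable B
      (Eventually.of_forall fun _ => hB _ (mem_univ _))
  obtain ⟨L, hL⟩ : ∃ L : ℝ, Tendsto (fun n : ℕ => (n : ℝ)⁻¹ *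
      ∑ j ∈ Finset.range n, φ (X (θ^[j] ω) : Circle1)) atTop (𝓝 L) := by
    by_contra hcon
    exact hω (hsub ⟨_, hint, hcon⟩)
  choose s hs hs' using fun n => ndsIter_coe_sub hf0 hε0 hε1 hf n ω t hκω hXω ht
  refine hno ⟨L, tendsto_cesaro_of_sub ?_ hL⟩
  have hdist : Tendsto (fun n => dist (s n : Circle1) (X (θ^[n] ω) : Circle1)) atTop (𝓝 0) := by
    have hgeom : Tendsto (fun n : ℕ => |(1/2 : ℝ) ^ n * (t - X ω)|) atTop (𝓝 0) := by
      simpa using ((tendsto_pow_atTop_nhds_zero_of_lt_one (r := (1/2 : ℝ))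
        (by norm_num) (by norm_num)).mul_const (t - X ω)).abs
    refine squeeze_zero (fun _ => dist_nonneg) (fun n => ?_) hgeom
    rw [dist_eq_norm, ← AddCircle.coe_sub, ← hs', ← Real.norm_eq_abs]
    exact QuotientAddGroup.norm_mk_le_norm
  have hφdist := Metric.uniformContinuous_iff.1 hφu
  refine Metric.tendsto_atTop.2 fun δ hδ => ?_
  obtain ⟨η, hη, hηφ⟩ := hφdist δ hδ
  obtain ⟨n₀, hn₀⟩ := Metric.tendsto_atTop.1 hdist η hη
  refine ⟨n₀, fun n hn => ?_⟩
  have := hn₀ n hn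
  rw [Real.dist_0_eq_abs, abs_of_nonneg dist_nonneg] at this
  rw [Real.dist_0_eq_abs, hs, ← Real.dist_eq]
  exact hηφ this

end
end

section
/- Let σ₁, σ₂ be positive real numbers with σ₁σ₂ > 1, and let (a_j)_{j≥1} and (b_j)_{j≥1} be sequences of positive real numbers satisfying a_j/b_j → σ₁ and b_{j+1}/a_j → σ₂ as j → ∞. Then (Σ_{j=1}^{J} a_j) / (Σ_{j=1}^{J} (a_j + b_j)) → σ₁/(1 + σ₁) as J → ∞. -/
open Filter Topology

/-- Stolz–Cesàro theorem for sums of positive terms. -/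
theorem tendsto_sum_range_div_sum_range {u g : ℕ → ℝ} {l : ℝ} (hg : ∀ n, 0 < g n)
    (hsum : Tendsto (fun n => ∑ i ∈ Finset.range n, g i) atTop atTop)
    (h : Tendsto (fun n => u n / g n) atTop (𝓝 l)) :
    Tendsto (fun n => (∑ i ∈ Finset.range n, u i) / ∑ i ∈ Finset.range n, g i) atTop (𝓝 l) := by
  have hlittle : (fun n => u n - l * g n) =o[atTop] g := by
    rw [Asymptotics.isLittleO_iff_tendsto fun n hn => absurd hn (hg n).ne']
    refine (tendsto_sub_nhds_zero_iff.2 h).congr fun n => ?_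
    have := (hg n).ne'
    field_simp
  have hlim := (hlittle.sum_range (fun n => (hg n).le) hsum).tendsto_div_nhds_zero
  rw [← tendsto_sub_nhds_zero_iff]
  refine hlim.congr' ?_
  filter_upwards [hsum.eventually_gt_atTop 0] with n hn
  rw [Finset.sum_sub_distrib, ← Finset.mul_sum, sub_div, mul_div_cancel_right₀ _ hn.ne']

theorem sum_Icc_one_eq_sum_range {M : Type*} [AddCommMonoid M] (f : ℕ → M) (n : ℕ) :
    ∑ i ∈ Finset.Icc 1 n, f i = ∑ i ∈ Finset.range n, f (i + 1) := by
  induction n with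
  | zero => simp
  | succ n ih => rw [Finset.sum_Icc_succ_top (by omega), Finset.sum_range_succ, ih]

/-- If `a_j/b_j → σ₁` and `b_{j+1}/a_j → σ₂` with `σ₁, σ₂ > 0` and `σ₁σ₂ > 1`,
then `(∑_{j=1}^J a_j)/(∑_{j=1}^J (a_j + b_j)) → σ₁/(1 + σ₁)`. -/
theorem sojourn_ratio_tendsto
    (σ1 σ2 : ℝ) (hσ1 : 0 < σ1) (hσ2 : 0 < σ2) (hσ12 : 1 < σ1 * σ2)
    (a b : ℕ → ℝ) (ha : ∀ j, 1 ≤ j → 0 < a j) (hb : ∀ j, 1 ≤ j → 0 < b j)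
    (hab : Tendsto (fun j => a j / b j) atTop (𝓝 σ1))
    (hba : Tendsto (fun j => b (j + 1) / a j) atTop (𝓝 σ2)) :
    Tendsto (fun J => (∑ j ∈ Finset.Icc 1 J, a j) / (∑ j ∈ Finset.Icc 1 J, (a j + b j)))
      atTop (𝓝 (σ1 / (1 + σ1))) := by
  have ha' : ∀ j, 0 < a (j + 1) := fun j => ha _ (by omega)
  have hb' : ∀ j, 0 < b (j + 1) := fun j => hb _ (by omega)
  have hratio : Tendsto (fun j => ‖b (j + 1 + 1)‖ / ‖b (j + 1)‖) atTop (𝓝 (σ1 * σ2)) := by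
    refine ((hab.mul hba).comp (tendsto_add_atTop_nat 1)).congr fun j => ?_
    rw [Real.norm_of_nonneg (hb' _).le, Real.norm_of_nonneg (hb' _).le]
    have := (ha' j).ne'
    have := (hb' j).ne'
    simp only [Function.comp_apply]
    field_simp
  have hbsum : Tendsto (fun n => ∑ i ∈ Finset.range n, b (i + 1)) atTop atTop :=
    (not_summable_iff_tendsto_nat_atTop_of_nonneg fun j => (hb' j).le).1
      (not_summable_of_ratio_test_tendsto_gt_one hσ12 hratio)
  simp only [sum_Icc_one_eq_sum_range]
  refine tendsto_sum_range_div_sum_range (fun j => add_pos (ha' j) (hb' j)) ?_ ?_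
  · refine tendsto_atTop_mono (fun n => Finset.sum_le_sum fun i _ => ?_) hbsum
    exact le_add_of_nonneg_left (ha' i).le
  · have hab' := hab.comp (tendsto_add_atTop_nat 1)
    refine (hab'.div (hab'.const_add 1) (by positivity)).congr fun j => ?_
    have := (ha' j).le
    have := hb' j
    simp only [Function.comp_apply, Pi.div_apply]
    field_simp
    ring
end

section
/- Let Ω be a metric space, φ : ℝ × Ω → Ω a continuous flow (φ^0 = id, φ^{s+t} = φ^s ∘ φ^t), θ = φ^1 its time-one map, p ≠ p̂ two points of Ω, and ω ∈ Ω. Suppose there are σ₁, σ₂ > 0 with σ₁σ₂ > 1 and a strictly increasing sequence of nonnegative times t₁ < t₂ < ⋯ → ∞ such that, setting T_j^{(p)} = t_{2j+1} − t_{2j} and T_j^{(p̂)} = t_{2j} − t_{2j−1}: (i) T_j^{(p)}/T_j^{(p̂)} → σ₁ and T_{j+1}^{(p̂)}/T_j^{(p)} → σ₂; (ii) for every δ > 0 and all sufficiently large j, {t ∈ [t_{2j}, t_{2j+1}] : φ^t ω ∈ U_δ(p)} and {t ∈ [t_{2j−1}, t_{2j}] : φ^t ω ∈ U_δ(p̂)}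 are intervals whose lengths T_{δ,j}^{(p)}, T_{δ,j}^{(p̂)} satisfy T_{δ,j}^{(p)}/T_j^{(p)} → 1 and T_{δ,j}^{(p̂)}/T_j^{(p̂)} → 1. Then for every integer ν ≥ 0 and every δ with 0 < δ < d_Ω(p,p̂)/2, setting n₁(J) = ⌊t_{2J+1}⌋ and n₂(J) = ⌊t_{2J}⌋, λ₁ = 1/(1+σ₁) and λ₂ = σ₂/(1+σ₂), one has for i = 1, 2: N_ν(ω, U_δ(p); n_i(J))/n_i(J) → 1 − λ_i and N_ν(ω, U_δ(p̂); n_i(J))/n_i(J) → λ_i as J → ∞; moreover λ₁ ≠ λ₂ since σ₁σ₂ > 1. -/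
open Filter Metric Set Topology

noncomputable section

/-- `j` is in a `ν`-trapped period of `ω` for `U` (w.r.t. the map `θ`). -/
def IsTrapped {Ω : Type*} (θ : Ω → Ω) (ν : ℕ) (ω : Ω) (U : Set Ω) (j : ℕ) : Prop :=
  ν ≤ j ∧ ∀ i ≤ ν, θ^[j - i] ω ∈ U

/-- `N_ν(ω, U; n)`: the number of `j ∈ [0, n-1]` in a `ν`-trapped period of `ω` for `U`. -/
def Ncount {Ω : Type*} (θ : Ω → Ω) (ν : ℕ) (ω : Ω) (U : Set Ω) (n : ℕ) : ℕ :=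
  {j : ℕ | j < n ∧ IsTrapped θ ν ω U j}.ncard

theorem Ncount_add_le {Ω : Type*} (θ : Ω → Ω) (ν : ℕ) (ω : Ω) (U : Set Ω) {m n u v : ℕ}
    (hmn : m ≤ n) (hmu : m ≤ u) (hvn : v ≤ n)
    (h : ∀ k, u ≤ k → k < v → IsTrapped θ ν ω U k) :
    Ncount θ ν ω U m + (v - u) ≤ Ncount θ ν ω U n := by
  classical
  have hfin : ∀ l, {j : ℕ | j < l ∧ IsTrapped θ ν ω U j}.Finite := fun l =>
    (Set.finite_lt_nat l).subset fun j hj => hj.1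
  have hdisj : Disjoint {j : ℕ | j < m ∧ IsTrapped θ ν ω U j} (Finset.Ico u v : Set ℕ) := by
    rw [Set.disjoint_left]
    rintro k ⟨hk, -⟩ hk'
    have := (Finset.mem_Ico.1 (Finset.mem_coe.1 hk')).1
    omega
  have hcard := Set.ncard_union_eq hdisj (hfin m) (Finset.finite_toSet _)
  rw [Set.ncard_coe_finset, Nat.card_Ico] at hcard
  unfold Ncount
  rw [← hcard]
  refine Set.ncard_le_ncard ?_ (hfin n)
  rintro k (⟨hk, hk'⟩ | hk)
  · exact ⟨by omega, hk'⟩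
  · obtain ⟨h₁, h₂⟩ := Finset.mem_Ico.1 (Finset.mem_coe.1 hk)
    exact ⟨by omega, h k h₁ h₂⟩

theorem Ncount_mono {Ω : Type*} (θ : Ω → Ω) (ν : ℕ) (ω : Ω) (U : Set Ω) :
    Monotone (Ncount θ ν ω U) := fun m n hmn => by
  simpa using Ncount_add_le θ ν ω U hmn le_rfl hmn fun k h₁ h₂ => absurd h₂ (by omega)

theorem Ncount_add_Ncount_le {Ω : Type*} (θ : Ω → Ω) (ν : ℕ) (ω : Ω) {U V : Set Ω}
    (hUV : Disjoint U V) (n : ℕ) : Ncount θ ν ω U n + Ncount θ ν ω V n ≤ n := by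
  have hfin : ∀ W : Set Ω, {j : ℕ | j < n ∧ IsTrapped θ ν ω W j}.Finite := fun W =>
    (Set.finite_lt_nat n).subset fun j hj => hj.1
  have hdisj : Disjoint {j : ℕ | j < n ∧ IsTrapped θ ν ω U j}
      {j : ℕ | j < n ∧ IsTrapped θ ν ω V j} := by
    rw [Set.disjoint_left]
    rintro k ⟨-, -, hk⟩ ⟨-, -, hk'⟩
    exact Set.disjoint_left.1 hUV (hk 0 (Nat.zero_le _)) (hk' 0 (Nat.zero_le _))
  unfold Ncount
  rw [← Set.ncard_union_eq hdisj (hfin U) (hfin V)]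
  calc _ ≤ (Finset.range n : Set ℕ).ncard :=
        Set.ncard_le_ncard (by rintro k (hk | hk) <;> simpa using hk.1) (Finset.finite_toSet _)
    _ = n := by rw [Set.ncard_coe_finset, Finset.card_range]

/-- An orbit segment staying in `U` during `(c, d) ⊆ [a, b]` contributes at least
`d - c - (ν + 2)` trapped times between `⌊a⌋` and `⌊b⌋`. -/
theorem Ncount_floor_add_le {Ω : Type*} (φ : ℝ → Ω → Ω) (θ : Ω → Ω) (ν : ℕ) (ω : Ω) (U : Set Ω)
    (hiter : ∀ k : ℕ, θ^[k] ω = φ k ω) {a b c d : ℝ} (ha : 0 ≤ a) (hab : a ≤ b)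
    (hsub : Set.Ioo c d ⊆ {s : ℝ | s ∈ Set.Icc a b ∧ φ s ω ∈ U}) :
    (Ncount θ ν ω U ⌊a⌋₊ : ℝ) + (d - c - (ν + 2)) ≤ Ncount θ ν ω U ⌊b⌋₊ := by
  have hfl : ⌊a⌋₊ ≤ ⌊b⌋₊ := Nat.floor_mono hab
  rcases le_or_gt d c with hdc | hcd
  · have h₁ : (Ncount θ ν ω U ⌊a⌋₊ : ℝ) ≤ Ncount θ ν ω U ⌊b⌋₊ := by
      exact_mod_cast Ncount_mono θ ν ω U hfl
    have : (0 : ℝ) ≤ ν := ν.cast_nonneg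
    linarith
  have hcl : Set.Icc c d ⊆ Set.Icc a b := by
    rw [← closure_Ioo hcd.ne]
    exact closure_minimal (fun s hs => (hsub hs).1) isClosed_Icc
  obtain ⟨hac, hdb⟩ := (Set.Icc_subset_Icc_iff hcd.le).1 hcl
  have hd0 : 0 < d := by linarith
  have hceil : 0 < ⌈d⌉₊ := Nat.ceil_pos.2 hd0
  have key := Ncount_add_le θ ν ω U (u := ⌊c⌋₊ + 1 + ν) (v := ⌈d⌉₊ - 1) hfl
    (by have := Nat.floor_mono hac; omega)
    (Nat.le_floor (by
      have := Nat.ceil_lt_add_one hd0.le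
      push_cast [Nat.cast_sub (show 1 ≤ ⌈d⌉₊ from hceil)]
      linarith))
    (fun k hk hkv => by
      refine ⟨by omega, fun i hi => ?_⟩
      rw [hiter]
      refine (hsub ⟨?_, ?_⟩).2
      · exact (Nat.floor_lt (ha.trans hac)).1 (by omega)
      · exact Nat.lt_ceil.1 (by omega))
  have key' : (Ncount θ ν ω U ⌊a⌋₊ : ℝ) + ((⌈d⌉₊ - 1 : ℕ) - (⌊c⌋₊ + 1 + ν : ℕ)) ≤
      Ncount θ ν ω U ⌊b⌋₊ := by
    rw [← Nat.cast_le (α := ℝ)] at key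
    have : ((⌈d⌉₊ - 1 : ℕ) : ℝ) ≤ (⌈d⌉₊ - 1 - (⌊c⌋₊ + 1 + ν) : ℕ) + (⌊c⌋₊ + 1 + ν : ℕ) := by
      exact_mod_cast Nat.sub_le_iff_le_add.1 le_rfl
    push_cast at key this ⊢
    linarith
  push_cast [Nat.cast_sub (show 1 ≤ ⌈d⌉₊ from hceil)] at key'
  have h₁ := Nat.le_ceil d
  have h₂ := Nat.floor_le (ha.trans hac)
  linarith

/-- The Stolz–Cesàro theorem for partial sums. -/
theorem tendsto_sum_div_sum {a b : ℕ → ℝ} {L : ℝ} (hb : ∀ j, 0 < b j)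
    (hsum : Tendsto (fun n => ∑ j ∈ Finset.range n, b j) atTop atTop)
    (h : Tendsto (fun j => a j / b j) atTop (𝓝 L)) :
    Tendsto (fun n => (∑ j ∈ Finset.range n, a j) / ∑ j ∈ Finset.range n, b j) atTop (𝓝 L) := by
  have h₁ : (fun j => a j - L * b j) =o[atTop] b := by
    rw [Asymptotics.isLittleO_iff_tendsto fun j hj => absurd hj (hb j).ne']
    have := h.sub_const L
    rw [sub_self] at this
    refine this.congr fun j => ?_
    have := (hb j).ne'
    field_simp
  have h₂ := (h₁.sum_range (fun j => (hb j).le) hsum).tendsto_div_nhds_zero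
  have h₃ := h₂.add_const L
  rw [zero_add] at h₃
  refine h₃.congr' ?_
  filter_upwards [hsum.eventually_gt_atTop 0] with n hn
  rw [Finset.sum_sub_distrib, ← Finset.mul_sum]
  field_simp
  ring

theorem tendsto_sum_range_atTop {b : ℕ → ℝ} (hb : ∀ j, 0 < b j) (h : Tendsto b atTop atTop) :
    Tendsto (fun n => ∑ j ∈ Finset.range n, b j) atTop atTop := by
  rw [← tendsto_add_atTop_iff_nat 1]
  refine tendsto_atTop_mono (fun n => ?_) h
  exact Finset.single_le_sum (fun j _ => (hb j).le) (Finset.self_mem_range_succ n)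

theorem tendsto_atTop_of_ratio {b : ℕ → ℝ} {r : ℝ} (hb : ∀ j, 0 < b j) (hr : 1 < r)
    (h : Tendsto (fun j => b (j + 1) / b j) atTop (𝓝 r)) : Tendsto b atTop atTop := by
  obtain ⟨c, hc1, hcr⟩ := exists_between hr
  obtain ⟨N, hN⟩ := eventually_atTop.1 (h.eventually_const_lt hcr)
  rw [← tendsto_add_atTop_iff_nat N]
  refine tendsto_atTop_of_geom_le (c := c) (hb _) hc1 fun n => ?_
  have := (lt_div_iff₀ (hb _)).1 (hN (n + N) (by omega))
  rw [show n + 1 + N = n + N + 1 by omega]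
  exact this.le

theorem tendsto_div_of_add {X Y τ : ℕ → ℝ} {c σ : ℝ} (hσ : 0 < σ)
    (hY : Tendsto Y atTop atTop) (hτ : ∀ n, τ n = c + X n + Y n)
    (h : Tendsto (fun n => X n / Y n) atTop (𝓝 σ)) :
    Tendsto (fun n => X n / τ n) atTop (𝓝 (σ / (1 + σ))) ∧
      Tendsto (fun n => Y n / τ n) atTop (𝓝 (1 / (1 + σ))) := by
  have h₁ : Tendsto (fun n => τ n / Y n) atTop (𝓝 (1 + σ)) := by
    have := ((hY.const_div_atTop c).add h).add_const 1
    rw [show (0 : ℝ) + σ + 1 = 1 + σ by ring] at this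
    refine this.congr' ?_
    filter_upwards [hY.eventually_gt_atTop 0] with n hn
    rw [hτ]
    field_simp
  have hne : 1 + σ ≠ 0 := by positivity
  constructor
  · refine (h.div h₁ hne).congr' ?_
    filter_upwards [hY.eventually_gt_atTop 0] with n hn
    exact div_div_div_cancel_right₀ hn.ne' _ _
  · rw [one_div]
    refine (h₁.inv₀ hne).congr fun n => inv_div _ _

theorem tendsto_sub_div_floor {G P τ : ℕ → ℝ} {μ : ℝ} (C : ℝ) (hP : Tendsto P atTop atTop)
    (hτ : Tendsto τ atTop atTop) (hG : Tendsto (fun n => G n / P n) atTop (𝓝 1))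
    (hPτ : Tendsto (fun n => P n / τ n) atTop (𝓝 μ)) :
    Tendsto (fun n => (G n - C) / (⌊τ n⌋₊ : ℝ)) atTop (𝓝 μ) := by
  have h₁ := (tendsto_nat_floor_div_atTop (R := ℝ)).comp hτ
  have h₂ := ((hG.sub (hP.const_div_atTop C)).mul hPτ).div h₁ one_ne_zero
  rw [sub_zero, one_mul, div_one] at h₂
  refine h₂.congr' ?_
  filter_upwards [hP.eventually_gt_atTop 0, hτ.eventually_gt_atTop 0] with n hn hn'
  simp only [Function.comp, Pi.div_apply]
  field_simp

/-- Two quantities with complementary lower asymptotic densities and total at most `s` have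
these densities as limits. -/
theorem tendsto_div_of_complementary {x y g h s : ℕ → ℝ} {α β : ℝ} (hαβ : α + β = 1)
    (hs : Tendsto s atTop atTop) (hx : ∀ᶠ n in atTop, g n ≤ x n) (hy : ∀ᶠ n in atTop, h n ≤ y n)
    (hxy : ∀ n, x n + y n ≤ s n) (hg : Tendsto (fun n => g n / s n) atTop (𝓝 α))
    (hh : Tendsto (fun n => h n / s n) atTop (𝓝 β)) :
    Tendsto (fun n => x n / s n) atTop (𝓝 α) ∧ Tendsto (fun n => y n / s n) atTop (𝓝 β) := by
  have hg' := hg.const_sub 1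
  have hh' := hh.const_sub 1
  rw [show 1 - α = β by linarith] at hg'
  rw [show 1 - β = α by linarith] at hh'
  constructor
  · refine tendsto_of_tendsto_of_tendsto_of_le_of_le' hg hh' ?_ ?_
    · filter_upwards [hs.eventually_gt_atTop 0, hx] with n h₀ h₁
      gcongr
    · filter_upwards [hs.eventually_gt_atTop 0, hy] with n h₀ h₁
      rw [one_sub_div h₀.ne']
      have := hxy n
      gcongr
      linarith
  · refine tendsto_of_tendsto_of_tendsto_of_le_of_le' hh hg' ?_ ?_
    · filter_upwards [hs.eventually_gt_atTop 0, hy] with n h₀ h₁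
      gcongr
    · filter_upwards [hs.eventually_gt_atTop 0, hx] with n h₀ h₁
      rw [one_sub_div h₀.ne']
      have := hxy n
      gcongr
      linarith

theorem exists_sum_sub_le {N a : ℕ → ℝ} (h : ∀ᶠ n in atTop, N n + a n ≤ N (n + 1)) :
    ∃ C, ∀ᶠ n in atTop, ∑ j ∈ Finset.range n, a j - C ≤ N n := by
  obtain ⟨M, hM⟩ := eventually_atTop.1 h
  refine ⟨∑ j ∈ Finset.range M, a j - N M, eventually_atTop.2 ⟨M, fun n hn => ?_⟩⟩
  induction n, hn using Nat.le_induction with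
  | base => linarith
  | succ n hn ih =>
    rw [Finset.sum_range_succ]
    have := hM n hn
    linarith

theorem tendsto_sum_sub_div_sum {D T : ℕ → ℝ} (K : ℝ) (hT : ∀ j, 0 < T j)
    (hTtop : Tendsto T atTop atTop) (h : Tendsto (fun j => D j / T j) atTop (𝓝 1)) :
    Tendsto (fun n => (∑ j ∈ Finset.range n, (D j - K)) / ∑ j ∈ Finset.range n, T j)
      atTop (𝓝 1) := by
  refine tendsto_sum_div_sum hT (tendsto_sum_range_atTop hT hTtop) ?_
  have := h.sub (hTtop.const_div_atTop K)
  rw [sub_zero] at this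
  exact this.congr fun j => (sub_div _ _ _).symm

/-- The analytic content of the Bowen-flow example: if the sojourn times of the
orbit of `ω` near the two saddles `p`, `p̂` have ratios converging to `σ₁` and `σ₂` with
`σ₁σ₂ > 1`, and the orbit spends all but a negligible fraction of each sojourn inside any fixed
`δ`-ball around the corresponding saddle, then the trapped-time frequencies along
`n₁(J) = ⌊t_{2J+1}⌋` and `n₂(J) = ⌊t_{2J}⌋` converge to `1 - λᵢ` and `λᵢ` with
`λ₁ = 1/(1+σ₁)`, `λ₂ = σ₂/(1+σ₂)`, and `λ₁ ≠ λ₂`. -/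
theorem bowen_flow_condition_H
    {Ω : Type*} [MetricSpace Ω]
    (φ : ℝ → Ω → Ω) (hφcont : Continuous fun q : ℝ × Ω => φ q.1 q.2)
    (hφ0 : ∀ x, φ 0 x = x) (hφadd : ∀ s t x, φ (s + t) x = φ s (φ t x))
    (θ : Ω → Ω) (hθ : ∀ x, θ x = φ 1 x)
    (p phat : Ω) (hp : p ≠ phat) (ω : Ω)
    (σ1 σ2 : ℝ) (hσ1 : 0 < σ1) (hσ2 : 0 < σ2) (hσ12 : 1 < σ1 * σ2)
    (t : ℕ → ℝ) (ht0 : ∀ j, 1 ≤ j → 0 ≤ t j)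
    (htmono : ∀ j, 1 ≤ j → t j < t (j + 1))
    (httop : Tendsto t atTop atTop)
    (Tp Tphat : ℕ → ℝ)
    (hTp : ∀ j, 1 ≤ j → Tp j = t (2 * j + 1) - t (2 * j))
    (hTphat : ∀ j, 1 ≤ j → Tphat j = t (2 * j) - t (2 * j - 1))
    (hratio1 : Tendsto (fun j => Tp j / Tphat j) atTop (𝓝 σ1))
    (hratio2 : Tendsto (fun j => Tphat (j + 1) / Tp j) atTop (𝓝 σ2))
    (Tdp Tdphat : ℝ → ℕ → ℝ)
    (hsojourn : ∀ δ : ℝ, 0 < δ →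
      (∃ J0 : ℕ, ∀ j ≥ J0, 1 ≤ j →
        (∃ c d : ℝ, c ≤ d ∧
          Set.Ioo c d ⊆ {s : ℝ | s ∈ Set.Icc (t (2 * j)) (t (2 * j + 1)) ∧ φ s ω ∈ ball p δ} ∧
          {s : ℝ | s ∈ Set.Icc (t (2 * j)) (t (2 * j + 1)) ∧ φ s ω ∈ ball p δ} ⊆ Set.Icc c d ∧
          Tdp δ j = d - c) ∧
        (∃ c d : ℝ, c ≤ d ∧
          Set.Ioo c d ⊆ {s : ℝ | s ∈ Set.Icc (t (2 * j - 1)) (t (2 * j)) ∧ φ s ω ∈ ball phat δ} ∧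
          {s : ℝ | s ∈ Set.Icc (t (2 * j - 1)) (t (2 * j)) ∧ φ s ω ∈ ball phat δ} ⊆ Set.Icc c d ∧
          Tdphat δ j = d - c)) ∧
      Tendsto (fun j => Tdp δ j / Tp j) atTop (𝓝 1) ∧
      Tendsto (fun j => Tdphat δ j / Tphat j) atTop (𝓝 1)) :
    (1 / (1 + σ1) : ℝ) ≠ σ2 / (1 + σ2) ∧
    ∀ ν : ℕ, ∀ δ : ℝ, 0 < δ → δ < dist p phat / 2 →
      Tendsto (fun J => (Ncount θ ν ω (ball p δ) (⌊t (2 * J + 1)⌋.toNat) : ℝ) /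
          (⌊t (2 * J + 1)⌋.toNat : ℝ)) atTop (𝓝 (1 - 1 / (1 + σ1))) ∧
      Tendsto (fun J => (Ncount θ ν ω (ball phat δ) (⌊t (2 * J + 1)⌋.toNat) : ℝ) /
          (⌊t (2 * J + 1)⌋.toNat : ℝ)) atTop (𝓝 (1 / (1 + σ1))) ∧
      Tendsto (fun J => (Ncount θ ν ω (ball p δ) (⌊t (2 * J)⌋.toNat) : ℝ) /
          (⌊t (2 * J)⌋.toNat : ℝ)) atTop (𝓝 (1 - σ2 / (1 + σ2))) ∧
      Tendsto (fun J => (Ncount θ ν ω (ball phat δ) (⌊t (2 * J)⌋.toNat) : ℝ) /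
          (⌊t (2 * J)⌋.toNat : ℝ)) atTop (𝓝 (σ2 / (1 + σ2))) := by
  have hne : (1 / (1 + σ1) : ℝ) ≠ σ2 / (1 + σ2) := by
    rw [Ne, div_eq_div_iff (by positivity) (by positivity)]
    intro h
    nlinarith
  refine ⟨hne, fun ν δ hδ hδ' => ?_⟩
  have hiter : ∀ k : ℕ, θ^[k] ω = φ k ω := fun k => by
    induction k with
    | zero => simp [hφ0]
    | succ k ih => rw [Function.iterate_succ_apply', ih, hθ, ← hφadd]; push_cast; rw [add_comm]
  have hTp' : ∀ j, Tp (j + 1) = t (2 * j + 3) - t (2 * j + 2) := fun j => hTp (j + 1) (by omega)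
  have hTh' : ∀ j, Tphat (j + 1) = t (2 * j + 2) - t (2 * j + 1) :=
    fun j => hTphat (j + 1) (by omega)
  have hTp0 : ∀ j, 0 < Tp (j + 1) := fun j => by
    rw [hTp']; exact sub_pos.2 (htmono (2 * j + 2) (by omega))
  have hTh0 : ∀ j, 0 < Tphat (j + 1) := fun j => by
    rw [hTh']; exact sub_pos.2 (htmono (2 * j + 1) (by omega))
  have hr1 := (tendsto_add_atTop_iff_nat 1).2 hratio1
  have hr2 := (tendsto_add_atTop_iff_nat 1).2 hratio2
  have hThtop : Tendsto (fun j => Tphat (j + 1)) atTop atTop := by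
    refine tendsto_atTop_of_ratio hTh0 hσ12 ((hr1.mul hr2).congr fun j => ?_)
    have h₁ := (hTp0 j).ne'
    have h₂ := (hTh0 j).ne'
    field_simp
  have hTptop : Tendsto (fun j => Tp (j + 1)) atTop atTop := by
    refine (hr1.pos_mul_atTop hσ1 hThtop).congr fun j => ?_
    exact div_mul_cancel₀ _ (hTh0 j).ne'
  set P : ℕ → ℝ := fun n => ∑ j ∈ Finset.range n, Tp (j + 1) with hPdef
  set H : ℕ → ℝ := fun n => ∑ j ∈ Finset.range n, Tphat (j + 1) with hHdef
  have hP : Tendsto P atTop atTop := tendsto_sum_range_atTop hTp0 hTptop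
  have hH : Tendsto H atTop atTop := tendsto_sum_range_atTop hTh0 hThtop
  have hH1 : Tendsto (fun n => H (n + 1)) atTop atTop := (tendsto_add_atTop_iff_nat 1).2 hH
  have htodd : ∀ n, t (2 * n + 1) = t 1 + P n + H n := fun n => by
    induction n with
    | zero => simp [hPdef, hHdef]
    | succ n ih =>
      simp only [hPdef, hHdef, Finset.sum_range_succ] at ih ⊢
      rw [hTp', hTh', show 2 * (n + 1) + 1 = 2 * n + 3 by ring]
      linarith
  have hteven : ∀ n, t (2 * (n + 1)) = t 1 + H (n + 1) + P n := fun n => by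
    have h₁ := htodd n
    have h₂ := hTh' n
    simp only [hHdef, Finset.sum_range_succ] at h₁ ⊢
    rw [show 2 * (n + 1) = 2 * n + 2 by ring]
    linarith
  have hPH : Tendsto (fun n => P n / H n) atTop (𝓝 σ1) := tendsto_sum_div_sum hTh0 hH hr1
  have hHP : Tendsto (fun n => H (n + 1) / P n) atTop (𝓝 σ2) := by
    have h₁ := (tendsto_sum_div_sum hTp0 hP hr2).add (hP.const_div_atTop (Tphat 1))
    rw [add_zero] at h₁
    refine h₁.congr fun n => ?_
    simp only [hHdef, hPdef]
    rw [Finset.sum_range_succ' _ n, add_div]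
  have htodd_top : Tendsto (fun n => t (2 * n + 1)) atTop atTop :=
    httop.comp (tendsto_atTop_mono (fun n => by simp only [id]; omega) tendsto_id)
  have hteven_top : Tendsto (fun n => t (2 * (n + 1))) atTop atTop :=
    httop.comp (tendsto_atTop_mono (fun n => by simp only [id]; omega) tendsto_id)
  obtain ⟨hPodd, hHodd⟩ := tendsto_div_of_add hσ1 hH htodd hPH
  obtain ⟨hHeven, hPeven⟩ := tendsto_div_of_add hσ2 hP hteven hHP
  obtain ⟨⟨J0, hJ0⟩, hDp, hDh⟩ := hsojourn δ hδ
  have hGp := tendsto_sum_sub_div_sum (ν + 2 : ℝ) hTp0 hTptop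
    ((tendsto_add_atTop_iff_nat 1).2 hDp)
  have hGh := tendsto_sum_sub_div_sum (ν + 2 : ℝ) hTh0 hThtop
    ((tendsto_add_atTop_iff_nat 1).2 hDh)
  have hdisj : Disjoint (ball p δ) (ball phat δ) := ball_disjoint_ball (by linarith)
  have hstep : ∀ (U : Set Ω) (j : ℕ), 1 ≤ j →
      (Ncount θ ν ω U ⌊t j⌋₊ : ℝ) ≤ Ncount θ ν ω U ⌊t (j + 1)⌋₊ := fun U j hj => by
    exact_mod_cast Ncount_mono θ ν ω U (Nat.floor_mono (htmono j hj).le)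
  have hincp : ∀ j ≥ J0, (Ncount θ ν ω (ball p δ) ⌊t (2 * j + 1)⌋₊ : ℝ) +
      (Tdp δ (j + 1) - (ν + 2)) ≤ Ncount θ ν ω (ball p δ) ⌊t (2 * (j + 1) + 1)⌋₊ := fun j hj => by
    obtain ⟨⟨c, d, -, hsub, -, hcd⟩, -⟩ := hJ0 (j + 1) (by omega) (by omega)
    rw [hcd]
    have h₁ := Ncount_floor_add_le φ θ ν ω _ hiter (ht0 (2 * (j + 1)) (by omega))
      (htmono (2 * (j + 1)) (by omega)).le hsub
    have h₂ := hstep (ball p δ) (2 * j + 1) (by omega)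
    rw [show 2 * j + 1 + 1 = 2 * (j + 1) by ring] at h₂
    linarith
  have hinch : ∀ j ≥ J0, (Ncount θ ν ω (ball phat δ) ⌊t (2 * j + 1)⌋₊ : ℝ) +
      (Tdphat δ (j + 1) - (ν + 2)) ≤ Ncount θ ν ω (ball phat δ) ⌊t (2 * (j + 1))⌋₊ :=
    fun j hj => by
    obtain ⟨-, c, d, -, hsub, -, hcd⟩ := hJ0 (j + 1) (by omega) (by omega)
    rw [hcd]
    exact Ncount_floor_add_le φ θ ν ω _ hiter (ht0 (2 * j + 1) (by omega))
      (htmono (2 * j + 1) (by omega)).le hsub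
  obtain ⟨C, hC⟩ := exists_sum_sub_le
    (N := fun n => (Ncount θ ν ω (ball p δ) ⌊t (2 * n + 1)⌋₊ : ℝ))
    (a := fun j => Tdp δ (j + 1) - (ν + 2)) (eventually_atTop.2 ⟨J0, hincp⟩)
  obtain ⟨C', hC'⟩ := exists_sum_sub_le
    (N := fun n => (Ncount θ ν ω (ball phat δ) ⌊t (2 * n + 1)⌋₊ : ℝ))
    (a := fun j => Tdphat δ (j + 1) - (ν + 2)) (eventually_atTop.2 ⟨J0, fun j hj =>
      (hinch j hj).trans (hstep _ (2 * (j + 1)) (by omega))⟩)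
  have hCe : ∀ᶠ n in atTop, ∑ j ∈ Finset.range n, (Tdp δ (j + 1) - (ν + 2)) - C ≤
      (Ncount θ ν ω (ball p δ) ⌊t (2 * (n + 1))⌋₊ : ℝ) := by
    filter_upwards [hC] with n hn
    exact hn.trans (hstep _ (2 * n + 1) (by omega))
  have hCe' : ∀ᶠ n in atTop, ∑ j ∈ Finset.range (n + 1), (Tdphat δ (j + 1) - (ν + 2)) - C' ≤
      (Ncount θ ν ω (ball phat δ) ⌊t (2 * (n + 1))⌋₊ : ℝ) := by
    filter_upwards [hC', eventually_ge_atTop J0] with n hn hn'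
    have := hinch n hn'
    rw [Finset.sum_range_succ]
    linarith
  have htotal : ∀ n : ℕ, (Ncount θ ν ω (ball p δ) n : ℝ) + Ncount θ ν ω (ball phat δ) n ≤ n :=
    fun n => by exact_mod_cast Ncount_add_Ncount_le θ ν ω hdisj n
  have hfloor : Tendsto (fun x : ℝ => (⌊x⌋₊ : ℝ)) atTop atTop :=
    tendsto_natCast_atTop_atTop.comp tendsto_nat_floor_atTop
  have hα₁ : σ1 / (1 + σ1) = 1 - 1 / (1 + σ1) := by field_simp; ring
  have hα₂ : 1 / (1 + σ2) = 1 - σ2 / (1 + σ2) := by field_simp; ring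
  rw [hα₁] at hPodd
  rw [hα₂] at hPeven
  obtain ⟨h₁, h₂⟩ := tendsto_div_of_complementary (by ring) (hfloor.comp htodd_top) hC hC'
    (fun n => htotal _) (tendsto_sub_div_floor C hP htodd_top hGp hPodd)
    (tendsto_sub_div_floor C' hH htodd_top hGh hHodd)
  obtain ⟨h₃, h₄⟩ := tendsto_div_of_complementary (by ring) (hfloor.comp hteven_top) hCe hCe'
    (fun n => htotal _) (tendsto_sub_div_floor C hP hteven_top hGp hPeven)
    (tendsto_sub_div_floor C' hH1 hteven_top ((tendsto_add_atTop_iff_nat 1).2 hGh) hHeven)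
  simp only [Int.floor_toNat]
  exact ⟨h₁, h₂, (tendsto_add_atTop_iff_nat 1).1 h₃, (tendsto_add_atTop_iff_nat 1).1 h₄⟩

end
end

section
/- Let n₀ ≥ 1, k₀ ≥ 1 and z₀ ≥ 1 be integers, and let (a_k)_{k≥k₀} and (b_k)_{k≥k₀} be sequences of positive integers with limsup_{k→∞} a_k/k < ∞ and limsup_{k→∞} b_k/k < ∞. Then there exists a strictly increasing sequence (k(J′))_{J′≥0} of integers with k(0) = k₀ such that, defining z_k = z₀ for k(J′−1) < k ≤ k(J′) when J′ is odd and z_k = z₀ + 1 when J′ is even (and z_{k₀} = z₀), m_k = (z_k + 1)k² + a_k + b_k and m̂_K = Σ_{k=k₀}^{K} m_k, the following holds: for every integer ν ≥ 0 there exists J′₀ such that for all J′ ≥ J′₀, with z_* = z₀ if J′ is odd and z_* = z₀ + 1 if J′ is even, (Σ_{k=k(J′−1)+1}^{k(J′)} (z_k k² − 2n₀ − ν)) / m̂_{k(J′)} ≥ z_*/(z_* + 1) − 2^{−J′} and (Σ_{k=k(J′−1)+1}^{k(J′)} (k² − 2n₀ − ν)) / m̂_{k(J′)} ≥ 1/(z_*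 + 1) − 2^{−J′}. -/
open Filter Topology

/-- An eventual linear bound on a sequence of naturals holds everywhere on `k ≥ 1`, up to
enlarging the constant. -/
lemma exists_forall_le_mul_of_eventually_div_le (a : ℕ → ℕ)
    (h : ∃ C : ℝ, ∀ᶠ k in atTop, (a k : ℝ) / (k : ℝ) ≤ C) :
    ∃ A : ℝ, 0 ≤ A ∧ ∀ k : ℕ, 1 ≤ k → (a k : ℝ) ≤ A * k := by
  obtain ⟨C, hC⟩ := h
  obtain ⟨n, hn⟩ := eventually_atTop.1 hC
  have hs : 0 ≤ ∑ i ∈ Finset.range n, (a i : ℝ) := Finset.sum_nonneg fun i _ => by positivity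
  refine ⟨max C 0 + ∑ i ∈ Finset.range n, (a i : ℝ), by positivity, fun k hk => ?_⟩
  have hk' : (1 : ℝ) ≤ k := by exact_mod_cast hk
  have hm : 0 ≤ max C 0 := le_max_right _ _
  rcases le_or_gt n k with hnk | hnk
  · have h1 := (div_le_iff₀ (by linarith)).1 (hn k hnk)
    nlinarith [le_max_left C 0]
  · have h1 : (a k : ℝ) ≤ ∑ i ∈ Finset.range n, (a i : ℝ) :=
      Finset.single_le_sum (f := fun i => (a i : ℝ)) (fun i _ => by positivity)
        (Finset.mem_range.2 hnk)
    nlinarith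

lemma cube_sub_cube_le_three_mul_sum_sq {M N : ℕ} (h : M ≤ N) :
    (N : ℝ) ^ 3 - (M : ℝ) ^ 3 ≤ 3 * ∑ k ∈ Finset.Icc (M + 1) N, (k : ℝ) ^ 2 := by
  induction N, h using Nat.le_induction with
  | base => simp
  | succ n hn ih =>
    rw [Finset.sum_Icc_succ_top (by omega)]
    push_cast
    nlinarith [(Nat.cast_nonneg n : (0 : ℝ) ≤ n)]

lemma sum_Icc_le_mul {l N : ℕ} (hl : 1 ≤ l) {f : ℕ → ℝ} {B : ℝ} (hB : 0 ≤ B)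
    (hf : ∀ k ∈ Finset.Icc l N, f k ≤ B) : ∑ k ∈ Finset.Icc l N, f k ≤ N * B := by
  refine (Finset.sum_le_card_nsmul _ _ _ hf).trans ?_
  rw [nsmul_eq_mul, Nat.card_Icc]
  gcongr
  omega

lemma div_sub_le_div_of_remainder_le {p q S R c ε : ℝ} (hpq : p ≤ q) (hq : 0 < q)
    (hS : 0 < S) (hR : 0 ≤ R) (hε : 0 ≤ ε) (h : R + c ≤ ε * (q * S)) :
    p / q - ε ≤ (p * S - c) / (q * S + R) := by
  rw [le_div_iff₀ (by positivity)]
  have h1 : p / q * (q * S + R) = p * S + p / q * R := by field_simp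
  have h2 : p / q * R ≤ R := mul_le_of_le_one_left hR ((div_le_one hq).2 hpq)
  nlinarith [mul_nonneg hε hR]

/-- The frequency estimate on a single block `(M, N]`, where the trapped times in the `k`-th
passage number `p * k² - c` out of `q * k² + d k`. -/
lemma block_frequency_ge {l M N : ℕ} (hl : 1 ≤ l) (hlM : l ≤ M) (hMN : M < N)
    {f d : ℕ → ℝ} {p q c A B ε : ℝ} (hpq : p ≤ q) (hq : 1 ≤ q) (hc : 0 ≤ c)
    (hA : 0 ≤ A) (hB : 0 ≤ B) (hε : 0 ≤ ε)
    (hd0 : ∀ k, 0 ≤ d k) (hd : ∀ k, 1 ≤ k → d k ≤ A * k)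
    (hf0 : ∀ k, 0 ≤ f k) (hfB : ∀ k ∈ Finset.Icc l M, f k ≤ B * (k : ℝ) ^ 2)
    (hf : ∀ k ∈ Finset.Icc (M + 1) N, f k = q * (k : ℝ) ^ 2 + d k)
    (hsmall : 3 * (B * (M : ℝ) ^ 3 + (A + c) * (N : ℝ) ^ 2) ≤ ε * ((N : ℝ) ^ 3 - (M : ℝ) ^ 3)) :
    p / q - ε ≤ (∑ k ∈ Finset.Icc (M + 1) N, (p * (k : ℝ) ^ 2 - c)) /
      ∑ k ∈ Finset.Icc l N, f k := by
  have hN : (1 : ℝ) ≤ N := by exact_mod_cast (by omega : 1 ≤ N)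
  have hsplit : ∑ k ∈ Finset.Icc l N, f k =
      ∑ k ∈ Finset.Icc l M, f k + ∑ k ∈ Finset.Icc (M + 1) N, f k := by
    simp only [← Finset.Ico_add_one_right_eq_Icc]
    exact (Finset.sum_Ico_consecutive f (by omega) (by omega)).symm
  have hinit : ∑ k ∈ Finset.Icc l M, f k ≤ M * (B * (M : ℝ) ^ 2) := by
    refine sum_Icc_le_mul hl (by positivity) fun k hk => (hfB k hk).trans ?_
    have := (Finset.mem_Icc.1 hk).2
    gcongr
  have hlin : ∑ k ∈ Finset.Icc (M + 1) N, d k ≤ N * (A * N) := by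
    refine sum_Icc_le_mul (by omega) (by positivity) fun k hk => ?_
    have hk := Finset.mem_Icc.1 hk
    refine (hd k (by omega)).trans ?_
    have := hk.2
    gcongr
  have hconst : ∑ k ∈ Finset.Icc (M + 1) N, c ≤ N * c :=
    sum_Icc_le_mul (by omega) hc fun _ _ => le_rfl
  have hsq := cube_sub_cube_le_three_mul_sum_sq hMN.le
  have hcube : (M : ℝ) ^ 3 < (N : ℝ) ^ 3 := by gcongr
  set S := ∑ k ∈ Finset.Icc (M + 1) N, (k : ℝ) ^ 2
  have hinit0 : 0 ≤ ∑ k ∈ Finset.Icc l M, f k := Finset.sum_nonneg fun k _ => hf0 k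
  have hlin0 : 0 ≤ ∑ k ∈ Finset.Icc (M + 1) N, d k := Finset.sum_nonneg fun k _ => hd0 k
  have hden : ∑ k ∈ Finset.Icc l N, f k =
      q * S + (∑ k ∈ Finset.Icc l M, f k + ∑ k ∈ Finset.Icc (M + 1) N, d k) := by
    rw [hsplit, Finset.sum_congr rfl hf, Finset.sum_add_distrib, ← Finset.mul_sum]
    ring
  rw [hden, Finset.sum_sub_distrib, ← Finset.mul_sum]
  refine div_sub_le_div_of_remainder_le hpq (by linarith) (by linarith) (by linarith) hε ?_
  have h1 : ε * S ≤ ε * (q * S) := by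
    gcongr
    nlinarith
  have h2 : (N : ℝ) * c ≤ c * (N : ℝ) ^ 2 := by
    nlinarith [mul_nonneg hc (by linarith : (0 : ℝ) ≤ N)]
  nlinarith [mul_le_mul_of_nonneg_left hsq hε]

/-- If consecutive block ends satisfy `4 ^ J * M ≤ N` and `4 ^ J ≤ N`, the remainder terms are
negligible with respect to `2⁻ᴶ * N³` for large `J`. -/
lemma remainder_le_half_pow_mul {J : ℕ} {M N P Q : ℝ} (hM : 0 ≤ M) (hP : 0 ≤ P) (hQ : 0 ≤ Q)
    (hMN : 4 ^ J * M ≤ N) (hN : 4 ^ J ≤ N) (hJ : 3 * P + 3 * Q + 1 ≤ 2 ^ J) :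
    3 * (P * M ^ 3 + Q * N ^ 2) ≤ (1 / 2 : ℝ) ^ J * (N ^ 3 - M ^ 3) := by
  set t : ℝ := 2 ^ J with ht
  have ht1 : 1 ≤ t := one_le_pow₀ (by norm_num)
  have h4 : (4 : ℝ) ^ J = t ^ 2 := by
    rw [ht, ← pow_mul, mul_comm, pow_mul]
    norm_num
  rw [h4] at hMN hN
  have ht2 : 1 ≤ t ^ 2 := one_le_pow₀ ht1
  have hN0 : 0 ≤ N := by linarith
  have hMN' : M ≤ N := by nlinarith
  have h1 : t ^ 2 * M ^ 3 ≤ N ^ 3 := by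
    calc t ^ 2 * M ^ 3 = t ^ 2 * M * M ^ 2 := by ring
      _ ≤ N * N ^ 2 := by gcongr
      _ = N ^ 3 := by ring
  have h2 : t ^ 2 * N ^ 2 ≤ N ^ 3 := by
    calc t ^ 2 * N ^ 2 ≤ N * N ^ 2 := by gcongr
      _ = N ^ 3 := by ring
  rw [one_div, inv_pow, ← ht, inv_mul_eq_div, le_div_iff₀ (by linarith)]
  have h3 : t * (t * (3 * (P * M ^ 3 + Q * N ^ 2)) + M ^ 3) ≤ t * N ^ 3 := by
    have h5 : t * M ^ 3 ≤ t ^ 2 * M ^ 3 := by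
      gcongr
      nlinarith
    have h6 : (3 * P + 3 * Q + 1) * N ^ 3 ≤ t * N ^ 3 := by gcongr
    nlinarith [mul_le_mul_of_nonneg_left h1 hP, mul_le_mul_of_nonneg_left h2 hQ]
  linarith [le_of_mul_le_mul_left h3 (by linarith)]

/-- The combinatorial estimate in the construction on Newhouse open sets: one
can choose the block boundaries `k(J')` so that, with `z_k = z₀` on odd blocks and `z_k = z₀ + 1`
on even blocks, `m_k = (z_k + 1)k² + a_k + b_k` and `m̂_K = ∑_{k=k₀}^K m_k`, the trapped-time
frequencies are bounded below by `z_*/(z_* + 1) - 2^{-J'}` and `1/(z_* + 1) - 2^{-J'}`. -/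
theorem newhouse_block_estimate
    (n0 k0 z0 : ℕ) (hn0 : 1 ≤ n0) (hk0 : 1 ≤ k0) (hz0 : 1 ≤ z0)
    (a b : ℕ → ℕ) (ha : ∀ k, k0 ≤ k → 0 < a k) (hb : ∀ k, k0 ≤ k → 0 < b k)
    (hla : ∃ C : ℝ, ∀ᶠ k in atTop, (a k : ℝ) / (k : ℝ) ≤ C)
    (hlb : ∃ C : ℝ, ∀ᶠ k in atTop, (b k : ℝ) / (k : ℝ) ≤ C) :
    ∃ kk : ℕ → ℕ, kk 0 = k0 ∧ StrictMono kk ∧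
      ∀ z : ℕ → ℕ, z k0 = z0 →
        (∀ J' : ℕ, 1 ≤ J' → ∀ k : ℕ, kk (J' - 1) < k → k ≤ kk J' →
          z k = if J' % 2 = 1 then z0 else z0 + 1) →
        ∀ ν : ℕ, ∃ J'0 : ℕ, ∀ J' : ℕ, J'0 ≤ J' → 1 ≤ J' →
          ((if J' % 2 = 1 then (z0 : ℝ) else (z0 : ℝ) + 1) /
              ((if J' % 2 = 1 then (z0 : ℝ) else (z0 : ℝ) + 1) + 1) - (1/2 : ℝ) ^ J' ≤
            (∑ k ∈ Finset.Icc (kk (J' - 1) + 1) (kk J'),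
                ((z k : ℝ) * (k : ℝ) ^ 2 - 2 * (n0 : ℝ) - (ν : ℝ))) /
              (∑ k ∈ Finset.Icc k0 (kk J'),
                (((z k : ℝ) + 1) * (k : ℝ) ^ 2 + (a k : ℝ) + (b k : ℝ)))) ∧
          ((1 : ℝ) / ((if J' % 2 = 1 then (z0 : ℝ) else (z0 : ℝ) + 1) + 1) - (1/2 : ℝ) ^ J' ≤
            (∑ k ∈ Finset.Icc (kk (J' - 1) + 1) (kk J'),
                ((k : ℝ) ^ 2 - 2 * (n0 : ℝ) - (ν : ℝ))) /
              (∑ k ∈ Finset.Icc k0 (kk J'),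
                (((z k : ℝ) + 1) * (k : ℝ) ^ 2 + (a k : ℝ) + (b k : ℝ)))) := by
  obtain ⟨A₁, hA₁, ha₁⟩ := exists_forall_le_mul_of_eventually_div_le a hla
  obtain ⟨A₂, hA₂, hb₂⟩ := exists_forall_le_mul_of_eventually_div_le b hlb
  refine ⟨fun J => k0 * 4 ^ (J * J), by simp, fun i j hij => ?_, fun z hz hzJ ν => ?_⟩
  · have : i * i < j * j := Nat.mul_self_lt_mul_self hij
    exact Nat.mul_lt_mul_of_pos_left (Nat.pow_lt_pow_right (by norm_num) this) hk0
  have hz_le : ∀ J k : ℕ, k0 ≤ k → k ≤ k0 * 4 ^ (J * J) → z k ≤ z0 + 1 := by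
    intro J
    induction J with
    | zero =>
      intro k h1 h2
      obtain rfl : k = k0 := by simp at h2; omega
      omega
    | succ n ih =>
      intro k h1 h2
      rcases le_or_gt k (k0 * 4 ^ (n * n)) with h | h
      · exact ih k h1 h
      · rw [hzJ (n + 1) (by omega) k (by simpa using h) h2]
        split_ifs <;> omega
  obtain ⟨J0, hJ0⟩ := pow_unbounded_of_one_lt
    (3 * ((z0 : ℝ) + 2 + (A₁ + A₂)) + 3 * ((A₁ + A₂) + (2 * n0 + ν)) + 1)
    (by norm_num : (1 : ℝ) < 2)
  refine ⟨J0, fun J hJ hJ1 => ?_⟩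
  have hz' := hzJ J hJ1
  have hzM := hz_le (J - 1)
  dsimp only at hz' ⊢
  set M := k0 * 4 ^ ((J - 1) * (J - 1)) with hM
  set N := k0 * 4 ^ (J * J) with hN
  have hpow : 4 ^ J * M ≤ N := by
    obtain ⟨n, rfl⟩ : ∃ n, J = n + 1 := ⟨J - 1, by omega⟩
    rw [hM, hN, mul_left_comm, ← pow_add]
    gcongr
    · norm_num
    · simp only [Nat.add_sub_cancel]
      nlinarith
  have hkM : k0 ≤ M := Nat.le_mul_of_pos_right _ (by positivity)
  have hNJ : 4 ^ J ≤ N := (Nat.le_mul_of_pos_right _ (by omega)).trans hpow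
  have hMN : M < N := by
    have : 4 ^ 1 ≤ 4 ^ J := Nat.pow_le_pow_right (by norm_num) hJ1
    nlinarith
  set w : ℝ := if J % 2 = 1 then (z0 : ℝ) else (z0 : ℝ) + 1 with hw
  have hw1 : 1 ≤ w := by
    have : (1 : ℝ) ≤ z0 := by exact_mod_cast hz0
    rw [hw]
    split_ifs <;> linarith
  have hzw : ∀ k ∈ Finset.Icc (M + 1) N, (z k : ℝ) = w := by
    intro k hk
    have hk := Finset.mem_Icc.1 hk
    rw [hz' k (by omega) hk.2, hw]
    split_ifs <;> simp
  have hsmall := remainder_le_half_pow_mul (J := J) (M := M) (N := N)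
    (P := (z0 : ℝ) + 2 + (A₁ + A₂)) (Q := (A₁ + A₂) + (2 * n0 + ν)) (by positivity)
    (by positivity) (by positivity) (by exact_mod_cast hpow) (by exact_mod_cast hNJ)
    (hJ0.le.trans (pow_le_pow_right₀ (by norm_num) hJ))
  have key : ∀ p : ℝ, p ≤ w + 1 → p / (w + 1) - (1 / 2 : ℝ) ^ J ≤
      (∑ k ∈ Finset.Icc (M + 1) N, (p * (k : ℝ) ^ 2 - (2 * (n0 : ℝ) + ν))) /
        ∑ k ∈ Finset.Icc k0 N, (((z k : ℝ) + 1) * (k : ℝ) ^ 2 + (a k : ℝ) + (b k : ℝ)) := by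
    intro p hpw
    refine block_frequency_ge (d := fun k => (a k : ℝ) + b k) hk0 hkM hMN hpw (by linarith)
      (by positivity) (add_nonneg hA₁ hA₂) (by positivity) (by positivity)
      (fun k => by positivity) (fun k hk => ?_) (fun k => by positivity) (fun k hk => ?_)
      (fun k hk => ?_) hsmall
    · linarith [ha₁ k hk, hb₂ k hk]
    · have hk := Finset.mem_Icc.1 hk
      have hzk : (z k : ℝ) ≤ z0 + 1 := by exact_mod_cast hzM k hk.1 hk.2
      have hk1 : (1 : ℝ) ≤ k := by exact_mod_cast hk0.trans hk.1
      have h1 := ha₁ k (hk0.trans hk.1)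
      have h2 := hb₂ k (hk0.trans hk.1)
      have h3 : (k : ℝ) ≤ (k : ℝ) ^ 2 := by nlinarith
      nlinarith [mul_le_mul_of_nonneg_left h3 hA₁, mul_le_mul_of_nonneg_left h3 hA₂,
        mul_le_mul_of_nonneg_right hzk (sq_nonneg (k : ℝ))]
    · rw [hzw k hk]
      ring
  constructor
  · convert key w (by linarith) using 2
    refine Finset.sum_congr rfl fun k hk => ?_
    rw [hzw k hk]
    ring
  · convert key 1 (by linarith) using 2
    refine Finset.sum_congr rfl fun k _ => ?_
    ring
end
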